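/- Let 0 < η < 1/2. There is a constant C > 0, depending only on η, such that for every f ∈ C_c^∞((0,∞)) (smooth, compactly supported in (0,∞)) one has ∫₀^∞ |f(s)|² s^{−2η} ds ≤ C ∫₀^∞ ∫₀^∞ |f(s) − f(t)|²/|s − t|^{1+2η} ds dt. Consequently the norms (∫₀^∞ |f(s)|² s^{−2η} ds + |f|_{H^η}² + ‖f‖_{L²(0,∞)}²)^{1/2} and (|f|_{H^η}² + ‖f‖_{L²(0,∞)}²)^{1/2} are equivalent on C_c^∞((0,∞)). -/

import Mathlib

open MeasureTheory Set

/-- The kernel `min(h², 1) / |h|^{1+2η}` is integrable on the line for `0 < η < 1`. -/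
lemma integrable_min_sq_one_div_abs_rpow {η : ℝ} (hη0 : 0 < η) (hη1 : η < 1) :
    Integrable (fun h : ℝ => min (h ^ 2) 1 / |h| ^ (1 + 2 * η)) := by
  set k : ℝ → ℝ := fun h => min (h ^ 2) 1 / |h| ^ (1 + 2 * η) with hk
  have h_small : IntegrableOn k (Ioc 0 1) := by
    have h : IntegrableOn (fun x : ℝ => x ^ (1 - 2 * η)) (Ioc 0 1) :=
      (intervalIntegrable_iff_integrableOn_Ioc_of_le zero_le_one).1
        (intervalIntegral.intervalIntegrable_rpow' (by linarith))
    refine h.congr_fun (fun x hx => ?_) measurableSet_Ioc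
    have hx2 : x ^ 2 ≤ 1 := by nlinarith [hx.1, hx.2]
    simp only [hk, min_eq_left hx2, abs_of_pos hx.1]
    rw [← Real.rpow_natCast x 2, ← Real.rpow_sub hx.1]
    congr 1
    push_cast
    ring
  have h_large : IntegrableOn k (Ioi 1) := by
    have h : IntegrableOn (fun x : ℝ => x ^ (-(1 + 2 * η))) (Ioi 1) :=
      integrableOn_Ioi_rpow_of_lt (by linarith) one_pos
    refine h.congr_fun (fun x hx => ?_) measurableSet_Ioi
    have hx1 : (1 : ℝ) < x := hx
    have hx2 : 1 ≤ x ^ 2 := by nlinarith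
    simp only [hk, min_eq_right hx2, abs_of_pos (one_pos.trans hx1)]
    rw [Real.rpow_neg (by linarith), one_div]
  have h_pos : Integrable ((Ioi (0 : ℝ)).indicator k) := by
    rw [integrable_indicator_iff measurableSet_Ioi, ← Ioc_union_Ioi_eq_Ioi zero_le_one]
    exact h_small.union h_large
  refine (h_pos.add h_pos.comp_neg).congr (Filter.Eventually.of_forall fun x => ?_)
  have h_even : k (-x) = k x := by simp [hk]
  rcases lt_trichotomy x 0 with hx | rfl | hx
  · simp [indicator, hx, hx.le, h_even]
  · simp [indicator, hk]
  · simp [indicator, hx, hx.le]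

/-- A compactly supported Lipschitz function has a finite Gagliardo seminorm of every order
`0 < η < 1`. -/
lemma LipschitzWith.integrable_gagliardo {E : Type*} [NormedAddCommGroup E] {f : ℝ → E}
    {L : NNReal} (hL : LipschitzWith L f) (hc : HasCompactSupport f)
    {η : ℝ} (hη0 : 0 < η) (hη1 : η < 1) :
    Integrable (fun p : ℝ × ℝ => ‖f p.1 - f p.2‖ ^ 2 / |p.1 - p.2| ^ (1 + 2 * η))
      (volume.prod volume) := by
  obtain ⟨M, hM⟩ := hc.exists_bound_of_continuous hL.continuous
  set A : ℝ := max ((L : ℝ) ^ 2) ((2 * M) ^ 2) with hA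
  have hA0 : 0 ≤ A := le_max_of_le_left (sq_nonneg _)
  set χ : ℝ → ℝ := (tsupport f).indicator 1 with hχ
  have hχ_int : Integrable χ := by
    rw [hχ, integrable_indicator_iff (isClosed_tsupport f).measurableSet]
    exact integrableOn_const hc.measure_lt_top.ne
  have hχ0 : ∀ x, 0 ≤ χ x := fun x => indicator_nonneg (fun _ _ => zero_le_one) x
  have hχ1 : ∀ x, f x ≠ 0 → χ x = 1 := fun x hx =>
    indicator_of_mem (subset_tsupport f hx) _
  have h_dom : Integrable (fun p : ℝ × ℝ =>
      χ p.2 * (min ((p.1 - p.2) ^ 2) 1 / |p.1 - p.2| ^ (1 + 2 * η))) (volume.prod volume) :=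
    hχ_int.convolution_integrand (ContinuousLinearMap.mul ℝ ℝ)
      (integrable_min_sq_one_div_abs_rpow hη0 hη1)
  refine ((h_dom.add h_dom.swap).const_mul A).mono' ?_ (Filter.Eventually.of_forall ?_)
  · have hf := hL.continuous
    have h1 : Continuous fun p : ℝ × ℝ => ‖f p.1 - f p.2‖ ^ 2 := by fun_prop
    exact (h1.measurable.div (by fun_prop)).aestronglyMeasurable
  · rintro ⟨s, t⟩
    have hst : ‖f s - f t‖ ^ 2 ≤ A * min ((s - t) ^ 2) 1 := by
      rw [mul_min_of_nonneg _ _ hA0]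
      refine le_min ?_ ?_
      · have h := hL.dist_le_mul s t
        rw [dist_eq_norm, Real.dist_eq] at h
        calc ‖f s - f t‖ ^ 2 ≤ (L * |s - t|) ^ 2 := by gcongr
          _ = (L : ℝ) ^ 2 * (s - t) ^ 2 := by rw [mul_pow, sq_abs]
          _ ≤ _ := by gcongr; exact le_max_left _ _
      · have h : ‖f s - f t‖ ≤ 2 * M := by linarith [_root_.norm_sub_le (f s) (f t), hM s, hM t]
        calc ‖f s - f t‖ ^ 2 ≤ (2 * M) ^ 2 := by gcongr
          _ ≤ A * 1 := by rw [mul_one]; exact le_max_right _ _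
    have hsupp : ‖f s - f t‖ ^ 2 ≤ A * min ((s - t) ^ 2) 1 * (χ t + χ s) := by
      have hm : 0 ≤ A * min ((s - t) ^ 2) 1 := by positivity
      by_cases hs : f s = 0
      · by_cases ht : f t = 0
        · simpa [hs, ht] using mul_nonneg hm (add_nonneg (hχ0 t) (hχ0 s))
        · exact hst.trans (le_mul_of_one_le_right hm (by linarith [hχ1 t ht, hχ0 s]))
      · exact hst.trans (le_mul_of_one_le_right hm (by linarith [hχ1 s hs, hχ0 t]))
    rw [Real.norm_of_nonneg (by positivity)]
    calc ‖f s - f t‖ ^ 2 / |s - t| ^ (1 + 2 * η)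
        ≤ A * min ((s - t) ^ 2) 1 * (χ t + χ s) / |s - t| ^ (1 + 2 * η) := by gcongr
      _ = _ := by
        simp only [Pi.add_apply, Function.comp_apply, Prod.swap_prod_mk]
        rw [abs_sub_comm t s, show (t - s) ^ 2 = (s - t) ^ 2 by ring]
        ring

/-- A continuous compactly supported function is square integrable against `s^{-2η}`, `η < 1/2`. -/
lemma HasCompactSupport.integrableOn_sq_norm_mul_rpow {E : Type*} [NormedAddCommGroup E]
    {f : ℝ → E} (hf : Continuous f) (hc : HasCompactSupport f) {η : ℝ} (hη : η < 1 / 2) :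
    IntegrableOn (fun s => ‖f s‖ ^ 2 * s ^ (-(2 * η))) (Ioi 0) := by
  obtain ⟨M, hM⟩ := hc.exists_bound_of_continuous hf
  obtain ⟨R, hR⟩ := hc.isCompact.isBounded.subset_closedBall 0
  have h : IntegrableOn (fun x : ℝ => x ^ (-(2 * η))) (Ioc 0 (max R 0)) :=
    (intervalIntegrable_iff_integrableOn_Ioc_of_le (le_max_right _ _)).1
      (intervalIntegral.intervalIntegrable_rpow' (by linarith))
  have h2 : IntegrableOn (fun s => ‖f s‖ ^ 2 * s ^ (-(2 * η))) (Ioc 0 (max R 0)) := by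
    refine Integrable.bdd_mul (c := M ^ 2) h
      (by fun_prop : Continuous fun s => ‖f s‖ ^ 2).aestronglyMeasurable
      (Filter.Eventually.of_forall fun x => ?_)
    rw [Real.norm_of_nonneg (by positivity)]
    gcongr
    exact hM x
  refine h2.of_forall_sdiff_eq_zero measurableSet_Ioi (fun x hx => ?_)
  have hx0 : 0 < x := hx.1
  have hfx : f x = 0 := by
    by_contra hne
    have := hR (subset_tsupport f hne)
    rw [Metric.mem_closedBall, dist_zero_right, Real.norm_of_nonneg hx0.le] at this
    exact hx.2 ⟨hx0, this.trans (le_max_left _ _)⟩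
  simp [hfx]

/-- Fractional Hardy inequality in `ℝ≥0∞`, for functions with finite weighted norm. The value
`f s` is compared with the values `f t` for `l * s < t < (l + 1) * s`. -/
lemma lintegral_fractional_hardy {E : Type*} [NormedAddCommGroup E] {f : ℝ → E}
    (hf : Continuous f) {η l : ℝ} (hη0 : 0 < η) (hl1 : 1 < l)
    (hl : 4 * (l + 1) ^ (2 * η) ≤ l)
    (hfin : ∫⁻ s in Ioi (0 : ℝ), ENNReal.ofReal (‖f s‖ ^ 2 * s ^ (-(2 * η))) ≠ ⊤) :
    ∫⁻ s in Ioi (0 : ℝ), ENNReal.ofReal (‖f s‖ ^ 2 * s ^ (-(2 * η))) ≤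
      ENNReal.ofReal (4 * l ^ (1 + 2 * η)) * ∫⁻ s in Ioi (0 : ℝ), ∫⁻ t in Ioi (0 : ℝ),
        ENNReal.ofReal (‖f s - f t‖ ^ 2 / |s - t| ^ (1 + 2 * η)) := by
  have hl0 : 0 < l := by linarith
  set S : Set (ℝ × ℝ) := {p | l * p.1 < p.2 ∧ p.2 < (l + 1) * p.1} with hS
  have hSm : MeasurableSet S :=
    (measurableSet_lt (f := fun p : ℝ × ℝ => l * p.1) (by fun_prop) measurable_snd).inter
      (measurableSet_lt (g := fun p : ℝ × ℝ => (l + 1) * p.1) measurable_snd (by fun_prop))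
  set w : ℝ × ℝ → ENNReal := S.indicator fun p => ENNReal.ofReal (p.1 ^ (-(1 + 2 * η))) with hw
  have hwm : Measurable w := Measurable.indicator (by fun_prop) hSm
  set g : ℝ → ENNReal := fun s => ENNReal.ofReal (‖f s‖ ^ 2) with hg
  have hgm : Measurable g :=
    (by fun_prop : Continuous fun s => ‖f s‖ ^ 2).measurable.ennreal_ofReal
  set D : ℝ × ℝ → ENNReal := fun p =>
    ENNReal.ofReal (‖f p.1 - f p.2‖ ^ 2 / |p.1 - p.2| ^ (1 + 2 * η)) with hD
  have hDm : Measurable D := by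
    have h1 : Continuous fun p : ℝ × ℝ => ‖f p.1 - f p.2‖ ^ 2 := by fun_prop
    exact (h1.measurable.div (by fun_prop)).ennreal_ofReal
  have h_fst : ∀ s > 0, ∫⁻ t in Ioi (0 : ℝ), w (s, t) = ENNReal.ofReal (s ^ (-(2 * η))) := by
    intro s hs
    have : ∀ t, w (s, t) = (Ioo (l * s) ((l + 1) * s)).indicator
        (fun _ => ENNReal.ofReal (s ^ (-(1 + 2 * η)))) t := fun t => rfl
    have h_sub : Ioo (l * s) ((l + 1) * s) ⊆ Ioi 0 := fun t ht =>
      (by positivity : 0 < l * s).trans ht.1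
    simp_rw [this]
    rw [lintegral_indicator_const measurableSet_Ioo,
      Measure.restrict_apply measurableSet_Ioo, inter_eq_left.2 h_sub, Real.volume_Ioo,
      ← ENNReal.ofReal_mul (by positivity), show (l + 1) * s - l * s = s by ring]
    congr 1
    rw [← Real.rpow_add_one hs.ne']
    congr 1
    ring
  have h_snd : ∀ t > 0, ∫⁻ s in Ioi (0 : ℝ), w (s, t) ≤
      ENNReal.ofReal (t ^ (-(2 * η)) / 4) := by
    intro t ht
    set c : ℝ := t / (l + 1) with hc
    have hc0 : 0 < c := by positivity
    have : ∀ s ∈ Ioi (0 : ℝ), w (s, t) ≤ (Ioo c (t / l)).indicator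
        (fun _ => ENNReal.ofReal (c ^ (-(1 + 2 * η)))) s := by
      intro s hs
      by_cases hst : (s, t) ∈ S
      · have h1 : c < s := by rw [hc, div_lt_iff₀ (by positivity)]; linarith [hst.2]
        have h2 : s < t / l := by rw [lt_div_iff₀ hl0]; linarith [hst.1]
        rw [hw, indicator_of_mem hst, indicator_of_mem (mem_Ioo.2 ⟨h1, h2⟩)]
        exact ENNReal.ofReal_le_ofReal
          (Real.rpow_le_rpow_of_nonpos hc0 h1.le (by linarith))
      · rw [hw, indicator_of_notMem hst]
        exact zero_le
    refine (setLIntegral_mono' measurableSet_Ioi this).trans ?_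
    refine (setLIntegral_le_lintegral _ _).trans ?_
    rw [lintegral_indicator_const measurableSet_Ioo, Real.volume_Ioo,
      ← ENNReal.ofReal_mul (by positivity)]
    refine ENNReal.ofReal_le_ofReal ?_
    have e1 : t / l - c = c / l := by rw [hc]; field_simp; ring
    have e2 : c ^ (-(1 + 2 * η)) * c = c ^ (-(2 * η)) := by
      rw [← Real.rpow_add_one hc0.ne']
      congr 1
      ring
    have e3 : c ^ (-(2 * η)) = t ^ (-(2 * η)) * (l + 1) ^ (2 * η) := by
      rw [hc, Real.div_rpow ht.le (by positivity), Real.rpow_neg (by positivity : 0 ≤ l + 1),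
        div_inv_eq_mul]
    rw [e1, ← mul_div_assoc, e2, e3, mul_div_assoc, div_eq_mul_one_div _ (4 : ℝ)]
    refine mul_le_mul_of_nonneg_left ?_ (by positivity)
    rw [div_le_div_iff₀ hl0 (by norm_num)]
    linarith
  have h_pt : ∀ s > 0, ∀ t, g s * w (s, t) ≤
      ENNReal.ofReal (2 * l ^ (1 + 2 * η)) * D (s, t) + 2 * (g t * w (s, t)) := by
    intro s hs t
    by_cases hst : (s, t) ∈ S
    · have h1 : l * s < t := hst.1
      have h2 : t < (l + 1) * s := hst.2
      have h0 : 0 < t - s := by nlinarith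
      have hts : |s - t| = t - s := by rw [abs_sub_comm, abs_of_pos h0]
      have hle : s ^ (-(1 + 2 * η)) ≤ l ^ (1 + 2 * η) / |s - t| ^ (1 + 2 * η) := by
        rw [Real.rpow_neg hs.le, le_div_iff₀ (by rw [hts]; positivity),
          inv_mul_le_iff₀ (by positivity), ← Real.mul_rpow hs.le hl0.le, hts]
        exact Real.rpow_le_rpow h0.le (by linarith) (by linarith)
      have hsq : ‖f s‖ ^ 2 ≤ 2 * ‖f s - f t‖ ^ 2 + 2 * ‖f t‖ ^ 2 := by
        have h : ‖f s‖ ≤ ‖f s - f t‖ + ‖f t‖ := by simpa using norm_add_le (f s - f t) (f t)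
        nlinarith [norm_nonneg (f s), sq_nonneg (‖f s - f t‖ - ‖f t‖)]
      rw [hw, indicator_of_mem hst]
      simp only [hg, hD]
      rw [← ENNReal.ofReal_mul (by positivity), ← ENNReal.ofReal_mul (by positivity),
        ← ENNReal.ofReal_mul (by positivity), show (2 : ENNReal) = ENNReal.ofReal 2 by simp,
        ← ENNReal.ofReal_mul (by positivity), ← ENNReal.ofReal_add (by positivity) (by positivity)]
      refine ENNReal.ofReal_le_ofReal ?_
      calc ‖f s‖ ^ 2 * s ^ (-(1 + 2 * η))
          ≤ (2 * ‖f s - f t‖ ^ 2 + 2 * ‖f t‖ ^ 2) * s ^ (-(1 + 2 * η)) := by gcongr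
        _ = 2 * ‖f s - f t‖ ^ 2 * s ^ (-(1 + 2 * η)) +
            2 * (‖f t‖ ^ 2 * s ^ (-(1 + 2 * η))) := by ring
        _ ≤ 2 * ‖f s - f t‖ ^ 2 * (l ^ (1 + 2 * η) / |s - t| ^ (1 + 2 * η)) +
            2 * (‖f t‖ ^ 2 * s ^ (-(1 + 2 * η))) := by gcongr
        _ = _ := by ring
    · rw [hw, indicator_of_notMem hst]
      simp
  set I := ∫⁻ s in Ioi (0 : ℝ), ENNReal.ofReal (‖f s‖ ^ 2 * s ^ (-(2 * η))) with hI
  set J := ∫⁻ s in Ioi (0 : ℝ), ∫⁻ t in Ioi (0 : ℝ), D (s, t) with hJ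
  have hI_eq : I = ∫⁻ s in Ioi (0 : ℝ), ∫⁻ t in Ioi (0 : ℝ), g s * w (s, t) := by
    refine setLIntegral_congr_fun measurableSet_Ioi fun s hs => ?_
    rw [lintegral_const_mul _ (by fun_prop), h_fst s hs, ← ENNReal.ofReal_mul (by positivity)]
  have h_tail : ∫⁻ s in Ioi (0 : ℝ), ∫⁻ t in Ioi (0 : ℝ), g t * w (s, t) ≤
      ENNReal.ofReal (1 / 4) * I := by
    rw [lintegral_lintegral_swap (by fun_prop), hI, ← lintegral_const_mul' _ _ (by finiteness)]
    refine setLIntegral_mono' measurableSet_Ioi fun t ht => ?_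
    rw [lintegral_const_mul _ (by fun_prop), ← ENNReal.ofReal_mul (by positivity)]
    refine (mul_le_mul_right (h_snd t ht) _).trans_eq ?_
    rw [← ENNReal.ofReal_mul (by positivity)]
    congr 1
    ring
  have h_main : I ≤ ENNReal.ofReal (2 * l ^ (1 + 2 * η)) * J +
      2 * (ENNReal.ofReal (1 / 4) * I) := by
    calc I = ∫⁻ s in Ioi (0 : ℝ), ∫⁻ t in Ioi (0 : ℝ), g s * w (s, t) := hI_eq
      _ ≤ ∫⁻ s in Ioi (0 : ℝ), ∫⁻ t in Ioi (0 : ℝ),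
          (ENNReal.ofReal (2 * l ^ (1 + 2 * η)) * D (s, t) + 2 * (g t * w (s, t))) :=
        setLIntegral_mono' measurableSet_Ioi fun s hs => lintegral_mono (h_pt s hs)
      _ = ENNReal.ofReal (2 * l ^ (1 + 2 * η)) * J +
          2 * ∫⁻ s in Ioi (0 : ℝ), ∫⁻ t in Ioi (0 : ℝ), g t * w (s, t) := by
        rw [hJ, ← lintegral_const_mul' _ _ (by finiteness), ← lintegral_const_mul' _ _ (by finiteness),
          ← lintegral_add_left
            ((Measurable.lintegral_prod_right' (f := D) hDm).const_mul _)]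
        refine lintegral_congr fun s => ?_
        rw [lintegral_add_left (by fun_prop), lintegral_const_mul' _ _ (by finiteness),
          lintegral_const_mul' _ _ (by finiteness)]
      _ ≤ _ := by gcongr
  by_cases hJtop : J = ⊤
  · rw [hJtop, ENNReal.mul_top (by simpa using by positivity)]
    exact le_top
  rw [← ENNReal.ofReal_toReal hfin, ← ENNReal.ofReal_toReal hJtop,
    show (2 : ENNReal) = ENNReal.ofReal 2 by simp,
    ← ENNReal.ofReal_mul (by positivity), ← ENNReal.ofReal_mul (by positivity),
    ← ENNReal.ofReal_mul (by positivity), ← ENNReal.ofReal_add (by positivity) (by positivity),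
    ENNReal.ofReal_le_ofReal_iff (by positivity)] at h_main
  rw [← ENNReal.ofReal_toReal hfin, ← ENNReal.ofReal_toReal hJtop,
    ← ENNReal.ofReal_mul (by positivity)]
  exact ENNReal.ofReal_le_ofReal (by linarith)

/-- Fractional Hardy inequality with an explicit constant. -/
lemma LipschitzWith.fractional_hardy {E : Type*} [NormedAddCommGroup E] {f : ℝ → E}
    {L : NNReal} (hL : LipschitzWith L f) (hc : HasCompactSupport f)
    {η l : ℝ} (hη0 : 0 < η) (hη : η < 1 / 2) (hl1 : 1 < l) (hl : 4 * (l + 1) ^ (2 * η) ≤ l) :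
    ∫ s in Ioi (0 : ℝ), ‖f s‖ ^ 2 * s ^ (-(2 * η)) ≤ 4 * l ^ (1 + 2 * η) *
      ∫ s in Ioi (0 : ℝ), ∫ t in Ioi (0 : ℝ), ‖f s - f t‖ ^ 2 / |s - t| ^ (1 + 2 * η) := by
  have h_int := hc.integrableOn_sq_norm_mul_rpow hL.continuous hη
  have h_gag : Integrable (fun p : ℝ × ℝ => ‖f p.1 - f p.2‖ ^ 2 / |p.1 - p.2| ^ (1 + 2 * η))
      ((volume.restrict (Ioi (0 : ℝ))).prod (volume.restrict (Ioi (0 : ℝ)))) := by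
    rw [Measure.prod_restrict]
    exact (hL.integrable_gagliardo hc hη0 (by linarith)).integrableOn
  have h_eq1 := ofReal_integral_eq_lintegral_ofReal h_int
    ((ae_restrict_iff' measurableSet_Ioi).2 <| Filter.Eventually.of_forall fun s hs => by
      have : (0 : ℝ) < s := hs
      simp only [Pi.zero_apply]
      positivity)
  have h_eq2 := ofReal_integral_eq_lintegral_ofReal h_gag.integral_prod_left
    (Filter.Eventually.of_forall fun s => integral_nonneg fun t => by
      simp only [Pi.zero_apply]
      positivity)
  have h_eq3 : ∫⁻ s in Ioi (0 : ℝ), ENNReal.ofReal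
        (∫ t in Ioi (0 : ℝ), ‖f s - f t‖ ^ 2 / |s - t| ^ (1 + 2 * η)) =
      ∫⁻ s in Ioi (0 : ℝ), ∫⁻ t in Ioi (0 : ℝ),
        ENNReal.ofReal (‖f s - f t‖ ^ 2 / |s - t| ^ (1 + 2 * η)) := by
    refine lintegral_congr_ae (h_gag.prod_right_ae.mono fun s hs => ?_)
    exact ofReal_integral_eq_lintegral_ofReal hs
      (Filter.Eventually.of_forall fun t => by simp only [Pi.zero_apply]; positivity)
  have h := lintegral_fractional_hardy hL.continuous hη0 hl1 hl
    (h_eq1 ▸ ENNReal.ofReal_ne_top)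
  rw [← h_eq1, ← h_eq3, ← h_eq2, ← ENNReal.ofReal_mul (by positivity)] at h
  refine (ENNReal.ofReal_le_ofReal_iff (mul_nonneg (by positivity) ?_)).1 h
  exact integral_nonneg fun s => integral_nonneg fun t => by
    simp only [Pi.zero_apply]
    positivity

/-- A dilation factor satisfying the hypotheses of `LipschitzWith.fractional_hardy` exists. -/
lemma exists_one_lt_four_mul_add_one_rpow_le {a : ℝ} (ha0 : 0 ≤ a) (ha : a < 1) :
    ∃ l : ℝ, 1 < l ∧ 4 * (l + 1) ^ a ≤ l := by
  have h1a : 0 < 1 - a := by linarith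
  refine ⟨8 ^ (1 / (1 - a)), Real.one_lt_rpow (by norm_num) (by positivity), ?_⟩
  set l : ℝ := 8 ^ (1 / (1 - a)) with hl
  have hl1 : 1 < l := Real.one_lt_rpow (by norm_num) (by positivity)
  have hl0 : 0 < l := by linarith
  have h8 : l ^ (1 - a) = 8 := by
    rw [hl, ← Real.rpow_mul (by norm_num), one_div_mul_cancel h1a.ne', Real.rpow_one]
  have h2 : (2 : ℝ) ^ a ≤ 2 := by
    simpa using Real.rpow_le_rpow_of_exponent_le one_le_two ha.le
  calc 4 * (l + 1) ^ a ≤ 4 * (2 * l) ^ a := by gcongr; linarith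
    _ = 4 * (2 ^ a * l ^ a) := by rw [Real.mul_rpow (by norm_num) hl0.le]
    _ ≤ 4 * (2 * l ^ a) := by gcongr
    _ = l ^ (1 - a) * l ^ a := by rw [h8]; ring
    _ = l := by rw [← Real.rpow_add hl0, sub_add_cancel, Real.rpow_one]

/-- fractional Hardy inequality, `0 < η < 1/2`: there is `C > 0`, depending only
on `η`, such that `∫₀^∞ |f(s)|² s^{−2η} ds ≤ C |f|_{H^η}²` for all `f ∈ C_c^∞((0,∞))`;
consequently the squared norms `∫₀^∞|f|²s^{−2η} + |f|_{H^η}² + ‖f‖_{L²}²` and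
`|f|_{H^η}² + ‖f‖_{L²}²` are equivalent on `C_c^∞((0,∞))`. -/
theorem fractional_hardy_inequality (η : ℝ) (hη1 : 0 < η) (hη2 : η < 1 / 2) :
    ∃ C > 0, ∀ f : ℝ → ℂ, ContDiff ℝ (⊤ : ℕ∞) f → HasCompactSupport f → tsupport f ⊆ Ioi 0 →
      (∫ s in Ioi (0 : ℝ), ‖f s‖ ^ 2 * s ^ (-(2 * η)) ≤
        C * ∫ s in Ioi (0 : ℝ), ∫ t in Ioi (0 : ℝ), ‖f s - f t‖ ^ 2 / |s - t| ^ (1 + 2 * η)) ∧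
      ((∫ s in Ioi (0 : ℝ), ∫ t in Ioi (0 : ℝ), ‖f s - f t‖ ^ 2 / |s - t| ^ (1 + 2 * η)) +
          (∫ s in Ioi (0 : ℝ), ‖f s‖ ^ 2) ≤
        (∫ s in Ioi (0 : ℝ), ‖f s‖ ^ 2 * s ^ (-(2 * η))) +
          (∫ s in Ioi (0 : ℝ), ∫ t in Ioi (0 : ℝ), ‖f s - f t‖ ^ 2 / |s - t| ^ (1 + 2 * η)) +
          (∫ s in Ioi (0 : ℝ), ‖f s‖ ^ 2)) ∧
      ((∫ s in Ioi (0 : ℝ), ‖f s‖ ^ 2 * s ^ (-(2 * η))) +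
          (∫ s in Ioi (0 : ℝ), ∫ t in Ioi (0 : ℝ), ‖f s - f t‖ ^ 2 / |s - t| ^ (1 + 2 * η)) +
          (∫ s in Ioi (0 : ℝ), ‖f s‖ ^ 2) ≤
        (1 + C) * ((∫ s in Ioi (0 : ℝ), ∫ t in Ioi (0 : ℝ),
            ‖f s - f t‖ ^ 2 / |s - t| ^ (1 + 2 * η)) +
          (∫ s in Ioi (0 : ℝ), ‖f s‖ ^ 2))) := by
  obtain ⟨l, hl1, hl⟩ :=
    exists_one_lt_four_mul_add_one_rpow_le (a := 2 * η) (by linarith) (by linarith)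
  have hl0 : 0 < l := by linarith
  refine ⟨4 * l ^ (1 + 2 * η), by positivity, fun f hf hc _ => ?_⟩
  obtain ⟨L, hL⟩ := hf.lipschitzWith_of_hasCompactSupport hc (by simp)
  have h := hL.fractional_hardy hc hη1 hη2 hl1 hl
  have h_weight : 0 ≤ ∫ s in Ioi (0 : ℝ), ‖f s‖ ^ 2 * s ^ (-(2 * η)) :=
    setIntegral_nonneg measurableSet_Ioi fun s hs => by
      have : (0 : ℝ) < s := hs
      positivity
  have h_L2 : 0 ≤ ∫ s in Ioi (0 : ℝ), ‖f s‖ ^ 2 := integral_nonneg fun s => by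
    simp only [Pi.zero_apply]
    positivity
  refine ⟨h, by linarith, ?_⟩
  have := mul_nonneg (by positivity : 0 ≤ 4 * l ^ (1 + 2 * η)) h_L2
  linarith
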